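/- arXiv:0901.4734 — 3 statements merged into one kernel-verified Lean document; each statement's English description precedes it below -/
import Mathlib

section
/- Let F be a free group with free generating set A, and let H be a subgroup of F. Suppose T ⊆ F is a Schreier transversal for the right cosets of H: T contains exactly one element of each right coset Hg, the identity 1 lies in T, and T is prefix-closed, i.e. every initial segment of the reduced word (over A ∪ A⁻¹) of an element of T is again the reduced word of an element of T. For g ∈ F let τ(g) denote the unique element of T with Hτ(g) = Hg. Then the set Y = { τ(g)·a·τ(ga)⁻¹ : g ∈ F, a ∈ A } \ {1} is a free basis of H: Y generates H, and the canonical homomorphism from the free group on the set Y to F (sending each element of Y to itself) is injective with image H. -/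
namespace FreeGroup

/-- Right translation of the argument, as an action of `G` on the group of functions `G → K`. -/
def translationAction (G K : Type*) [Group G] [Group K] : G →* MulAut (G → K) where
  toFun w :=
    { toFun := fun f g => f (g * w)
      invFun := fun f g => f (g * w⁻¹)
      left_inv := fun f => by simp
      right_inv := fun f => by simp
      map_mul' := fun _ _ => rfl }
  map_one' := by ext; simp
  map_mul' v w := by ext; simp [mul_assoc]

variable {A K : Type*} [Group K] (s : FreeGroup A → A → K)

/-- The homomorphism to the wreath product whose first component is `FreeGroup.cocycle s`. -/
def cocycleHom :
    FreeGroup A →* (FreeGroup A → K) ⋊[translationAction (FreeGroup A) K] FreeGroup A :=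
  lift fun a => ⟨fun g => s g a, of a⟩

/-- The crossed homomorphism extending `s`: the product of the labels `s` along the path
labelled `w` starting at `g` in the Cayley graph. -/
def cocycle (g w : FreeGroup A) : K := (cocycleHom s w).left g

theorem cocycleHom_right (w : FreeGroup A) : (cocycleHom s w).right = w := by
  have h : SemidirectProduct.rightHom.comp (cocycleHom s) = MonoidHom.id (FreeGroup A) := by
    ext a; simp [cocycleHom]
  exact DFunLike.congr_fun h w

@[simp]
theorem cocycle_of (g : FreeGroup A) (a : A) : cocycle s g (of a) = s g a := by
  simp [cocycle, cocycleHom]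

@[simp]
theorem cocycle_one (g : FreeGroup A) : cocycle s g 1 = 1 := by
  simp [cocycle]

theorem cocycle_mul (g v w : FreeGroup A) :
    cocycle s g (v * w) = cocycle s g v * cocycle s (g * v) w := by
  have h : (cocycleHom s (v * w)).left = _ :=
    congrArg SemidirectProduct.left (_root_.map_mul (cocycleHom s) v w)
  rw [SemidirectProduct.mul_left, cocycleHom_right] at h
  exact congrFun h g

theorem cocycle_inv (g w : FreeGroup A) :
    cocycle s g w⁻¹ = (cocycle s (g * w⁻¹) w)⁻¹ := by
  rw [eq_inv_iff_mul_eq_one, ← cocycle_mul, inv_mul_cancel, cocycle_one]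

variable {s}

theorem cocycle_mul_left {h : FreeGroup A} (hs : ∀ g a, s (h * g) a = s g a)
    (g w : FreeGroup A) : cocycle s (h * g) w = cocycle s g w := by
  induction w using FreeGroup.induction_on generalizing g with
  | C1 => simp
  | of a => simp [hs]
  | inv_of a _ => simp [cocycle_inv, mul_assoc, hs]
  | mul v w hv hw => rw [cocycle_mul, cocycle_mul, hv, mul_assoc, hw]

theorem map_cocycle {G : Type*} [Group G] (f : K →* G) (p : FreeGroup A →* G)
    (τ : FreeGroup A → G) (hf : ∀ g a, f (s g a) = τ g * p (of a) * (τ (g * of a))⁻¹)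
    (g w : FreeGroup A) : f (cocycle s g w) = τ g * p w * (τ (g * w))⁻¹ := by
  induction w using FreeGroup.induction_on generalizing g with
  | C1 => simp
  | of a => simp [hf]
  | inv_of a _ => simp [cocycle_inv, hf, mul_assoc]
  | mul v w hv hw => simp [cocycle_mul, hv, hw, mul_assoc]

/-- The cocycle is trivial along a path that stays in a set `T` on whose edges `s` is trivial. -/
theorem cocycle_mk_eq_one {T : Set (FreeGroup A)}
    (hs : ∀ t ∈ T, ∀ a, t * of a ∈ T → s t a = 1) (L : List (A × Bool))
    (hL : ∀ n, mk (L.take n) ∈ T) : cocycle s 1 (mk L) = 1 := by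
  induction L using List.reverseRecOn with
  | nil => exact cocycle_one s 1
  | append_singleton L x ih =>
    have hpre (n : ℕ) : mk (L.take n) ∈ T := by
      have h := hL (min n L.length)
      rwa [List.take_append_of_le_length (min_le_right _ _), ← List.take_eq_take_min] at h
    have hmem : mk L ∈ T := by simpa using hpre L.length
    have hmem' : mk L * mk [x] ∈ T := by
      have h := hL (L ++ [x]).length
      rwa [List.take_length, ← mul_mk] at h
    rw [← mul_mk, cocycle_mul, ih hpre, one_mul, one_mul]
    obtain ⟨a, _ | _⟩ := x
    · have hx : (mk [(a, false)] : FreeGroup A) = (of a)⁻¹ := rfl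
      rw [hx] at hmem' ⊢
      rw [cocycle_inv, cocycle_of, hs _ hmem' a (by simpa using hmem), inv_one]
    · exact (cocycle_of s _ a).trans (hs _ hmem a hmem')

end FreeGroup

/-- **Nielsen–Schreier via Schreier transversals.** If `T` is a prefix-closed (Schreier)
transversal for the right cosets of a subgroup `H` of a free group, with coset
representative map `τ`, then the nontrivial elements `τ(g)·a·τ(ga)⁻¹` form a free basis
of `H`. -/
theorem schreier_transversal_free_basis {A : Type*} [DecidableEq A]
    (H : Subgroup (FreeGroup A)) (T : Set (FreeGroup A))
    (τ : FreeGroup A → FreeGroup A)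
    -- `1 ∈ T`
    (hT1 : (1 : FreeGroup A) ∈ T)
    -- `T` is prefix-closed: every initial segment of the reduced word of an element of `T`
    -- is the reduced word of an element of `T`
    (hTpref : ∀ t ∈ T, ∀ n : ℕ, ∃ t' ∈ T, FreeGroup.toWord t' = (FreeGroup.toWord t).take n)
    -- `τ g` is the element of `T` in the right coset `Hg`
    (hτT : ∀ g : FreeGroup A, τ g ∈ T)
    (hτcoset : ∀ g : FreeGroup A, g * (τ g)⁻¹ ∈ H)
    -- `T` contains exactly one element of each right coset
    (hTuniq : ∀ t ∈ T, ∀ t' ∈ T, t * t'⁻¹ ∈ H → t = t')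
    (Y : Set (FreeGroup A))
    (hY : Y = {y | (∃ (g : FreeGroup A) (a : A),
        y = τ g * FreeGroup.of a * (τ (g * FreeGroup.of a))⁻¹) ∧ y ≠ 1}) :
    Subgroup.closure Y = H ∧
      Function.Injective ⇑(FreeGroup.lift (fun y : Y => (y : FreeGroup A))) ∧
      (FreeGroup.lift (fun y : Y => (y : FreeGroup A))).range = H := by
  classical
  have hτeq {g g' : FreeGroup A} (h : g * g'⁻¹ ∈ H) : τ g = τ g' := by
    refine hTuniq _ (hτT g) _ (hτT g') ?_
    have := H.mul_mem (H.mul_mem (H.inv_mem (hτcoset g)) h) (hτcoset g')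
    simpa [mul_assoc] using this
  have hτself {t : FreeGroup A} (ht : t ∈ T) : τ t = t :=
    (hTuniq t ht _ (hτT t) (hτcoset t)).symm
  have hτmul {h : FreeGroup A} (hh : h ∈ H) (g : FreeGroup A) : τ (h * g) = τ g :=
    hτeq (by simpa using hh)
  have hττ (g : FreeGroup A) (w : FreeGroup A) : τ (τ g * w) = τ (g * w) :=
    (hτeq (by simpa [mul_assoc] using hτcoset g)).symm
  let y (g : FreeGroup A) (a : A) : FreeGroup A :=
    τ g * FreeGroup.of a * (τ (g * FreeGroup.of a))⁻¹
  have hyY (g : FreeGroup A) (a : A) (h : y g a ≠ 1) : y g a ∈ Y := by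
    rw [hY]; exact ⟨⟨g, a, rfl⟩, h⟩
  have hyH (g : FreeGroup A) (a : A) : y g a ∈ H := by
    have := hτcoset (τ g * FreeGroup.of a)
    rwa [hττ] at this
  have hYH : Y ⊆ H := by
    rw [hY]
    rintro _ ⟨⟨g, a, rfl⟩, -⟩
    exact hyH g a
  let s (g : FreeGroup A) (a : A) : FreeGroup Y :=
    if h : y g a = 1 then 1 else FreeGroup.of ⟨y g a, hyY g a h⟩
  have hs_congr {g g' : FreeGroup A} {a : A} (h : y g a = y g' a) : s g a = s g' a := by
    simp only [s, h]
  have hs_left {h : FreeGroup A} (hh : h ∈ H) (g w : FreeGroup A) :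
      FreeGroup.cocycle s (h * g) w = FreeGroup.cocycle s g w :=
    FreeGroup.cocycle_mul_left
      (fun g a => hs_congr (by simp only [y, mul_assoc, hτmul hh])) g w
  have hs_one {h : FreeGroup A} (hh : h ∈ H) (w : FreeGroup A) :
      FreeGroup.cocycle s h w = FreeGroup.cocycle s 1 w := by
    simpa using hs_left hh 1 w
  have hsT {t : FreeGroup A} (ht : t ∈ T) : FreeGroup.cocycle s 1 t = 1 := by
    rw [← FreeGroup.mk_toWord (x := t)]
    refine FreeGroup.cocycle_mk_eq_one (T := T) (fun t ht a hta => ?_) _ (fun n => ?_)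
    · exact dif_pos (by simp [y, hτself ht, hτself hta])
    · obtain ⟨t', ht', h⟩ := hTpref t ht n
      rwa [← h, FreeGroup.mk_toWord]
  let f : FreeGroup Y →* FreeGroup A := FreeGroup.lift (fun y : Y => (y : FreeGroup A))
  have hrange_closure : f.range = Subgroup.closure Y :=
    (FreeGroup.closure_eq_range Y).symm
  have hfH (k : FreeGroup Y) : f k ∈ H :=
    (Subgroup.closure_le H).2 hYH (hrange_closure ▸ ⟨k, rfl⟩)
  have hfs (g : FreeGroup A) (a : A) : f (s g a) = y g a := by
    by_cases h : y g a = 1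
    · simp [s, h]
    · simp [s, h, f]
  have hrange : f.range = H := by
    refine le_antisymm (by rintro _ ⟨k, rfl⟩; exact hfH k) fun h hh => ?_
    refine ⟨FreeGroup.cocycle s 1 h, ?_⟩
    have hτh : τ h = 1 := by rw [hτeq (g' := 1) (by simpa using hh), hτself hT1]
    rw [FreeGroup.map_cocycle f (MonoidHom.id _) τ hfs, one_mul, hτh, hτself hT1]
    simp
  have hleft : Function.LeftInverse (FreeGroup.cocycle s 1) f := fun k => by
    induction k using FreeGroup.induction_on with
    | C1 => simp
    | of z =>
      obtain ⟨z, hz⟩ := z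
      obtain ⟨⟨g, a, rfl⟩, hne⟩ := hY ▸ hz
      have hy : y (τ g) a = y g a := by simp only [y, hττ, hτself (hτT g)]
      have hcancel : FreeGroup.cocycle s (τ g * FreeGroup.of a) (τ (g * FreeGroup.of a))⁻¹ = 1 := by
        rw [FreeGroup.cocycle_inv, hs_one (hyH g a), hsT (hτT _), inv_one]
      simp only [f, FreeGroup.lift_apply_of]
      rw [FreeGroup.cocycle_mul, FreeGroup.cocycle_mul, one_mul, one_mul, hcancel, hsT (hτT g),
        FreeGroup.cocycle_of, one_mul, mul_one, hs_congr hy]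
      exact dif_neg hne
    | inv_of z hz =>
      rw [map_inv, FreeGroup.cocycle_inv, one_mul, hs_one (H.inv_mem (hfH _)), hz]
    | mul j k hj hk =>
      rw [map_mul, FreeGroup.cocycle_mul, one_mul, hs_one (hfH j), hj, hk]
  exact ⟨hrange_closure.symm.trans hrange, hleft.injective, hrange⟩
end

section
/- Equip the product space (A ∪ A⁻¹)^ℕ with the product measure P of the uniform distributions assigning probability 1/(2m) to each letter, and for a sequence x = (x₁, x₂, …) let gₙ(x) = x₁x₂⋯xₙ ∈ F (the position at time n of the simple random walk on F). Then for P-almost every x there exists a (necessarily unique) boundary point ω(x) ∈ ∂F such that (gₙ(x) | ω(x)) → ∞ as n → ∞, and the pushforward of P under the map x ↦ ω(x) equals the uniform measure μ on ∂F. -/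
open MeasureTheory Filter Topology
open scoped ENNReal symmDiff

noncomputable section

/-- A letter of the alphabet `A ∪ A⁻¹` for the free group on `Fin m`. -/
abbrev Letter (m : ℕ) := Fin m × Bool

/-- The inverse letter. -/
def linv {m : ℕ} (x : Letter m) : Letter m := (x.1, !x.2)

/-- A sequence of letters is reduced if no letter is followed by its inverse. -/
def IsRedSeq {m : ℕ} (ω : ℕ → Letter m) : Prop := ∀ n, ω (n + 1) ≠ linv (ω n)

/-- The boundary `∂F`: infinite reduced words. -/
abbrev Boundary (m : ℕ) := {ω : ℕ → Letter m // IsRedSeq ω}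

/-- Word length of an element of the free group. -/
def wlen {m : ℕ} (g : FreeGroup (Fin m)) : ℕ := g.toWord.length

/-- The truncation `[ω]ₙ`: the group element given by the first `n` letters of `ω`. -/
def trunc {m : ℕ} (ω : Boundary m) (n : ℕ) : FreeGroup (Fin m) :=
  FreeGroup.mk (List.ofFn fun i : Fin n => ω.1 i)

/-- Cylinder set `C_g`. -/
def cylinder {m : ℕ} (g : FreeGroup (Fin m)) : Set (Boundary m) :=
  {ω | trunc ω (wlen g) = g}

/-- The Gromov product `(g|ω)`: length of the longest common initial segment of the
reduced word of `g` and `ω`. -/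
def gromov {m : ℕ} (g : FreeGroup (Fin m)) (ω : Boundary m) : ℕ :=
  sSup {k | ∀ i < k, g.toWord[i]? = some (ω.1 i)}

/-- The Busemann function `b_ω(g) = |g| - 2 (g|ω)`. -/
def busemann {m : ℕ} (g : FreeGroup (Fin m)) (ω : Boundary m) : ℤ :=
  (wlen g : ℤ) - 2 * (gromov g ω : ℤ)

/-- The number of letters cancelled in the free reduction of the concatenation
of a finite word `w` with an infinite reduced word `ω`. -/
def cancelLen {m : ℕ} (w : List (Letter m)) (ω : ℕ → Letter m) : ℕ :=
  sSup {k | k ≤ w.length ∧ ∀ i < k, w[w.length - 1 - i]? = some (linv (ω i))}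

/-- The sequence of letters of the free reduction of (reduced word of `g`) ++ `ω`. -/
def actSeq {m : ℕ} (g : FreeGroup (Fin m)) (ω : Boundary m) (n : ℕ) : Letter m :=
  if h : n < g.toWord.length - cancelLen g.toWord ω.1
  then g.toWord[n]'(by omega)
  else ω.1 (n - (g.toWord.length - cancelLen g.toWord ω.1) + cancelLen g.toWord ω.1)

theorem linv_linv {m : ℕ} (x : Letter m) : linv (linv x) = x := by
  simp [linv]

theorem toWord_chain {m : ℕ} (g : FreeGroup (Fin m)) {j : ℕ} (hj : j + 1 < g.toWord.length) :
    g.toWord[j + 1]'hj ≠ linv (g.toWord[j]'(by omega)) := by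
  intro h
  have hsplit : g.toWord = g.toWord.take j ++
      (g.toWord[j]'(by omega)) :: (g.toWord[j+1]'hj) :: g.toWord.drop (j + 2) := by
    conv_lhs => rw [← List.take_append_drop j g.toWord]
    congr 1
    rw [List.drop_eq_getElem_cons (by omega)]
    congr 1
    rw [List.drop_eq_getElem_cons (by omega)]
  rw [h] at hsplit
  have hred : FreeGroup.reduce g.toWord = g.toWord := FreeGroup.reduce_toWord g
  exact FreeGroup.reduce.not (by rw [hred, hsplit]; rfl)

theorem cancelLen_spec {m : ℕ} (w : List (Letter m)) (ω : ℕ → Letter m) :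
    cancelLen w ω ≤ w.length ∧
      ∀ i < cancelLen w ω, w[w.length - 1 - i]? = some (linv (ω i)) := by
  have : cancelLen w ω ∈
      {k | k ≤ w.length ∧ ∀ i < k, w[w.length - 1 - i]? = some (linv (ω i))} := by
    apply Nat.sSup_mem ⟨0, by simp⟩ ⟨w.length, fun x hx => hx.1⟩
  exact this

theorem cancelLen_max {m : ℕ} (w : List (Letter m)) (ω : ℕ → Letter m)
    (hlt : cancelLen w ω < w.length) :
    w[w.length - 1 - cancelLen w ω]? ≠ some (linv (ω (cancelLen w ω))) := by
  intro hcon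
  have hmem : cancelLen w ω + 1 ∈
      {k | k ≤ w.length ∧ ∀ i < k, w[w.length - 1 - i]? = some (linv (ω i))} := by
    refine ⟨hlt, fun i hi => ?_⟩
    rcases Nat.lt_succ_iff_lt_or_eq.mp hi with h | h
    · exact (cancelLen_spec w ω).2 i h
    · subst h; exact hcon
  have := le_csSup ⟨w.length, fun x hx => hx.1⟩ hmem
  simp only [cancelLen] at this ⊢
  omega

theorem isRedSeq_actSeq {m : ℕ} (g : FreeGroup (Fin m)) (ω : Boundary m) :
    IsRedSeq (actSeq g ω) := by
  intro n
  obtain ⟨hkle, hcan⟩ := cancelLen_spec g.toWord ω.1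
  by_cases h1 : n + 1 < g.toWord.length - cancelLen g.toWord ω.1
  · have h0 : n < g.toWord.length - cancelLen g.toWord ω.1 := by omega
    rw [show actSeq g ω (n + 1) = g.toWord[n + 1]'(by omega) from dif_pos h1,
        show actSeq g ω n = g.toWord[n]'(by omega) from dif_pos h0]
    exact toWord_chain g (by omega)
  · by_cases h0 : n < g.toWord.length - cancelLen g.toWord ω.1
    · have hklt : cancelLen g.toWord ω.1 < g.toWord.length := by omega
      have hidx : n = g.toWord.length - 1 - cancelLen g.toWord ω.1 := by omega
      have e0 : actSeq g ω n = g.toWord[n]'(by omega) := dif_pos h0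
      have e1 : actSeq g ω (n + 1) =
          ω.1 (n + 1 - (g.toWord.length - cancelLen g.toWord ω.1) +
            cancelLen g.toWord ω.1) := dif_neg h1
      have harg : n + 1 - (g.toWord.length - cancelLen g.toWord ω.1) +
          cancelLen g.toWord ω.1 = cancelLen g.toWord ω.1 := by omega
      rw [harg] at e1
      rw [e0, e1]
      intro hcon
      apply cancelLen_max g.toWord ω.1 hklt
      subst hidx
      rw [List.getElem?_eq_getElem (by omega), hcon, linv_linv]
    · have e0 : actSeq g ω n =
          ω.1 (n - (g.toWord.length - cancelLen g.toWord ω.1) +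
            cancelLen g.toWord ω.1) := dif_neg h0
      have e1 : actSeq g ω (n + 1) =
          ω.1 (n + 1 - (g.toWord.length - cancelLen g.toWord ω.1) +
            cancelLen g.toWord ω.1) := dif_neg (by omega)
      have harg : n + 1 - (g.toWord.length - cancelLen g.toWord ω.1) +
          cancelLen g.toWord ω.1 =
          (n - (g.toWord.length - cancelLen g.toWord ω.1) + cancelLen g.toWord ω.1) + 1 := by
        omega
      rw [e0, e1, harg]
      exact ω.2 _

/-- The boundary action of `F` on `∂F`: `g · ω` is the free reduction of the
concatenation of the reduced word of `g` with `ω`. -/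
def bact {m : ℕ} (g : FreeGroup (Fin m)) (ω : Boundary m) : Boundary m :=
  ⟨actSeq g ω, isRedSeq_actSeq g ω⟩


section FreeGroupWords

variable {m : ℕ}

theorem toWord_mk_of_isReduced {L : List (Letter m)} (hL : FreeGroup.IsReduced L) :
    (FreeGroup.mk L).toWord = L := by
  rw [FreeGroup.toWord_mk, hL.reduce_eq]

theorem mk_linv_mul_mk (a : Letter m) :
    (FreeGroup.mk [linv a] * FreeGroup.mk [a] : FreeGroup (Fin m)) = 1 := by
  have h : (FreeGroup.mk [linv a] : FreeGroup (Fin m)) = (FreeGroup.mk [a])⁻¹ := by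
    simp [FreeGroup.inv_mk, FreeGroup.invRev, linv]
  rw [h, inv_mul_cancel]

theorem toWord_mul_mk_singleton (g : FreeGroup (Fin m)) (a : Letter m) :
    (g * FreeGroup.mk [a]).toWord =
      if g.toWord.getLast? = some (linv a) then g.toWord.dropLast else g.toWord ++ [a] := by
  split_ifs with h
  · have hsplit : g.toWord = g.toWord.dropLast ++ [linv a] :=
      (List.dropLast_append_getLast? _ h).symm
    have hred : FreeGroup.IsReduced g.toWord.dropLast :=
      FreeGroup.isReduced_toWord.infix (List.dropLast_prefix _).isInfix
    have hg : g = FreeGroup.mk g.toWord.dropLast * FreeGroup.mk [linv a] := by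
      rw [FreeGroup.mul_mk, ← hsplit, FreeGroup.mk_toWord]
    conv_lhs => rw [hg, mul_assoc, mk_linv_mul_mk, mul_one, toWord_mk_of_isReduced hred]
  · have hred : FreeGroup.IsReduced (g.toWord ++ [a]) := by
      refine List.isChain_append.2 ⟨FreeGroup.isReduced_toWord, List.isChain_singleton a, ?_⟩
      intro x hx y hy hxy
      simp only [List.head?_cons, Option.mem_def, Option.some.injEq] at hx hy
      subst hy
      by_contra hne
      apply h
      rw [hx]
      congr 1
      ext1
      · exact hxy
      · exact Bool.eq_not.2 hne
    conv_lhs => rw [← FreeGroup.mk_toWord (x := g), FreeGroup.mul_mk, toWord_mk_of_isReduced hred]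

theorem wlen_mul_mk_singleton (g : FreeGroup (Fin m)) (a : Letter m) :
    wlen (g * FreeGroup.mk [a]) =
      if g.toWord.getLast? = some (linv a) then wlen g - 1 else wlen g + 1 := by
  rw [wlen, toWord_mul_mk_singleton]
  split_ifs <;> simp [wlen]

theorem take_toWord_mul_mk_singleton (g : FreeGroup (Fin m)) (a : Letter m) {k : ℕ}
    (hk : k ≤ wlen g) (hk' : k ≤ wlen (g * FreeGroup.mk [a])) :
    (g * FreeGroup.mk [a]).toWord.take k = g.toWord.take k := by
  rw [wlen, toWord_mul_mk_singleton] at hk'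
  rw [toWord_mul_mk_singleton]
  split_ifs with h
  · rw [if_pos h, List.length_dropLast] at hk'
    rw [List.dropLast_eq_take, List.take_take, min_eq_left hk']
  · exact List.take_append_of_le_length hk

theorem wlen_eq_zero_iff {g : FreeGroup (Fin m)} : wlen g = 0 ↔ g = 1 := by
  rw [wlen, List.length_eq_zero_iff, FreeGroup.toWord_eq_nil_iff]

/-- Summing a function of the word length over the neighbours of `g` in the Cayley tree. -/
theorem sum_wlen_mul_mk_singleton (g : FreeGroup (Fin m)) (φ : ℕ → ℝ≥0∞) :
    ∑ a : Letter m, φ (wlen (g * FreeGroup.mk [a])) =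
      if wlen g = 0 then (2 * m : ℕ) * φ 1
      else φ (wlen g - 1) + (2 * m - 1 : ℕ) * φ (wlen g + 1) := by
  simp_rw [wlen_mul_mk_singleton]
  split_ifs with h
  · have hnil : g.toWord = [] := List.length_eq_zero_iff.1 h
    simp [hnil, h, mul_comm]
  · obtain ⟨b, hb⟩ : ∃ b, g.toWord.getLast? = some b := by
      rw [← Option.isSome_iff_exists, List.getLast?_isSome]
      exact fun h' => h (List.length_eq_zero_iff.2 h')
    have hiff : ∀ a : Letter m, g.toWord.getLast? = some (linv a) ↔ a = linv b := fun a => by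
      rw [hb, Option.some_inj]
      exact ⟨fun h => by rw [h, linv_linv], fun h => by rw [h, linv_linv]⟩
    simp_rw [hiff]
    rw [← Finset.add_sum_erase _ _ (Finset.mem_univ (linv b)), if_pos rfl,
      Finset.sum_congr rfl (g := fun _ => φ (wlen g + 1))
        fun a ha => by rw [if_neg (Finset.ne_of_mem_erase ha)]]
    simp [Finset.card_erase_of_mem, mul_comm]

theorem isReduced_ofFn (ω : Boundary m) (n : ℕ) :
    FreeGroup.IsReduced (List.ofFn fun i : Fin n => ω.1 i) := by
  refine List.isChain_iff_getElem.2 fun i hi h => ?_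
  simp only [List.getElem_ofFn] at h ⊢
  by_contra hne
  refine ω.2 i (Prod.ext h.symm ?_)
  exact Bool.eq_not.2 (Ne.symm hne)

theorem toWord_trunc (ω : Boundary m) (n : ℕ) :
    (trunc ω n).toWord = List.ofFn fun i : Fin n => ω.1 i :=
  toWord_mk_of_isReduced (isReduced_ofFn ω n)

theorem wlen_trunc (ω : Boundary m) (n : ℕ) : wlen (trunc ω n) = n := by
  rw [wlen, toWord_trunc, List.length_ofFn]

theorem mem_cylinder_iff {g : FreeGroup (Fin m)} {ω : Boundary m} :
    ω ∈ cylinder g ↔ ∀ i < wlen g, g.toWord[i]? = some (ω.1 i) := by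
  change trunc ω (wlen g) = g ↔ _
  rw [← FreeGroup.toWord_inj, toWord_trunc]
  constructor
  · intro h i hi
    rw [← h]
    simp [hi]
  · intro h
    refine List.ext_getElem (by simp [wlen]) fun i h₁ h₂ => ?_
    have := h i h₂
    rw [List.getElem?_eq_getElem h₂, Option.some_inj] at this
    simp [this]

theorem le_gromov_iff {g : FreeGroup (Fin m)} {ω : Boundary m} {k : ℕ} :
    k ≤ gromov g ω ↔ ∀ i < k, g.toWord[i]? = some (ω.1 i) := by
  have hbdd : BddAbove {k | ∀ i < k, g.toWord[i]? = some (ω.1 i)} := by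
    refine ⟨wlen g, fun k hk => ?_⟩
    by_contra! hlt
    have := hk _ hlt
    simp [wlen] at this
  refine ⟨fun h i hi => ?_, fun h => le_csSup hbdd h⟩
  exact Nat.sSup_mem ⟨0, by simp⟩ hbdd i (hi.trans_le h)

theorem eq_of_tendsto_gromov {u : ℕ → FreeGroup (Fin m)} {ω₁ ω₂ : Boundary m}
    (h₁ : Tendsto (fun n => gromov (u n) ω₁) atTop atTop)
    (h₂ : Tendsto (fun n => gromov (u n) ω₂) atTop atTop) : ω₁ = ω₂ := by
  ext1
  funext i
  obtain ⟨n, hn₁, hn₂⟩ :=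
    ((h₁.eventually_ge_atTop (i + 1)).and (h₂.eventually_ge_atTop (i + 1))).exists
  have e₁ := le_gromov_iff.1 hn₁ i i.lt_succ_self
  have e₂ := le_gromov_iff.1 hn₂ i i.lt_succ_self
  exact Option.some_inj.1 (e₁.symm.trans e₂)

theorem prefix_trunc_iff {g : FreeGroup (Fin m)} {ω : Boundary m} {n : ℕ} :
    g.toWord <+: (trunc ω n).toWord ↔ wlen g ≤ n ∧ ω ∈ cylinder g := by
  have aux : ∀ i < n, (trunc ω n).toWord[i]? = some (ω.1 i) := fun i hi => by
    simp [toWord_trunc, hi]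
  constructor
  · intro h
    have hle : wlen g ≤ n := by simpa [wlen, toWord_trunc] using h.length_le
    refine ⟨hle, mem_cylinder_iff.2 fun i hi => ?_⟩
    rw [← aux i (hi.trans_le hle), List.prefix_iff_getElem?.1 h i hi]
    exact List.getElem?_eq_getElem hi
  · rintro ⟨hle, h⟩
    refine List.prefix_iff_getElem?.2 fun i hi => ?_
    rw [aux i (lt_of_lt_of_le hi hle), ← mem_cylinder_iff.1 h i hi]
    exact List.getElem?_eq_getElem hi

end FreeGroupWords

section RandomWalk

variable {m : ℕ}

instance : MeasurableSpace (FreeGroup (Fin m)) := ⊤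

instance : DiscreteMeasurableSpace (FreeGroup (Fin m)) := ⟨fun _ => trivial⟩

/-- The position `x₁x₂⋯xₙ` at time `n` of the walk with increments `x`. -/
def walk (n : ℕ) (x : ℕ → Letter m) : FreeGroup (Fin m) :=
  FreeGroup.mk (List.ofFn fun i : Fin n => x i)

theorem mk_ofFn_snoc {n : ℕ} (f : Fin n → Letter m) (a : Letter m) :
    FreeGroup.mk (List.ofFn (Fin.snoc f a : Fin (n + 1) → Letter m)) =
      FreeGroup.mk (List.ofFn f) * FreeGroup.mk [a] := by
  rw [List.ofFn_succ_last, FreeGroup.mul_mk]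
  simp

theorem walk_succ (n : ℕ) (x : ℕ → Letter m) :
    walk (n + 1) x = walk n x * FreeGroup.mk [x n] := by
  rw [walk, List.ofFn_succ_last, walk, FreeGroup.mul_mk]
  simp

theorem measurable_walk (n : ℕ) : Measurable (walk n : (ℕ → Letter m) → FreeGroup (Fin m)) := by
  have h : Measurable fun (x : ℕ → Letter m) (i : Fin n) => x i :=
    measurable_pi_lambda _ fun i => measurable_pi_apply _
  exact (measurable_of_countable
    fun f : Fin n → Letter m => FreeGroup.mk (List.ofFn f)).comp h

theorem measurableSet_walk (n : ℕ) (p : FreeGroup (Fin m) → Prop) :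
    MeasurableSet {x : ℕ → Letter m | p (walk n x)} :=
  measurable_walk n (MeasurableSet.of_discrete (s := {g | p g}))

/-- The law of the first `n` increments is uniform for every `n`. -/
def IsUniformIncrements (P : Measure (ℕ → Letter m)) : Prop :=
  ∀ (n : ℕ) (f : Fin n → Letter m),
    P {x | ∀ i : Fin n, x i = f i} = (((2 * m : ℕ) : ℝ≥0∞))⁻¹ ^ n

variable {P : Measure (ℕ → Letter m)}

theorem IsUniformIncrements.lintegral_restrict (hP : IsUniformIncrements P) (n : ℕ)
    (ψ : (Fin n → Letter m) → ℝ≥0∞) :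
    ∫⁻ x, ψ (fun i => x i) ∂P = ((2 * m : ℕ) : ℝ≥0∞)⁻¹ ^ n * ∑ f, ψ f := by
  have h : Measurable fun (x : ℕ → Letter m) (i : Fin n) => x i :=
    measurable_pi_lambda _ fun i => measurable_pi_apply _
  rw [← lintegral_map (measurable_of_countable ψ) h, lintegral_fintype, Finset.mul_sum]
  refine Finset.sum_congr rfl fun f _ => ?_
  rw [Measure.map_apply h (measurableSet_singleton f), mul_comm, ← hP n f]
  congr 2
  ext x
  exact funext_iff

theorem IsUniformIncrements.lintegral_walk_succ (hP : IsUniformIncrements P) (n : ℕ)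
    (φ : FreeGroup (Fin m) → ℝ≥0∞) :
    ∫⁻ x, φ (walk (n + 1) x) ∂P =
      ((2 * m : ℕ) : ℝ≥0∞)⁻¹ * ∑ a, ∫⁻ x, φ (walk n x * FreeGroup.mk [a]) ∂P := by
  have h₁ := hP.lintegral_restrict (n + 1) fun f => φ (FreeGroup.mk (List.ofFn f))
  have h₂ := fun a =>
    hP.lintegral_restrict n fun f => φ (FreeGroup.mk (List.ofFn f) * FreeGroup.mk [a])
  simp only [walk]
  rw [h₁]
  simp_rw [h₂]
  rw [← Finset.mul_sum, ← mul_assoc, ← pow_succ', ← (Fin.snocEquiv fun _ => Letter m).sum_comp,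
    Fintype.sum_prod_type]
  simp only [Fin.snocEquiv, Equiv.coe_fn_mk, mk_ofFn_snoc]

theorem IsUniformIncrements.measure_walk_succ (hP : IsUniformIncrements P) (n : ℕ)
    (g : FreeGroup (Fin m)) :
    P (walk (n + 1) ⁻¹' {g}) =
      ((2 * m : ℕ) : ℝ≥0∞)⁻¹ * ∑ a, P (walk n ⁻¹' {g * FreeGroup.mk [a]}) := by
  have hind : ∀ (k : ℕ) (h : FreeGroup (Fin m)),
      P (walk k ⁻¹' {h}) = ∫⁻ x, Set.indicator {h} 1 (walk k x) ∂P := fun k h => by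
    rw [← lintegral_indicator_one (measurable_walk k (measurableSet_singleton h))]
    rfl
  rw [hind, hP.lintegral_walk_succ,
    ← Equiv.sum_comp (Function.Involutive.toPerm (linv : Letter m → Letter m) linv_linv)]
  congr 1
  refine Finset.sum_congr rfl fun a _ => ?_
  rw [hind]
  refine lintegral_congr fun x => ?_
  have hinv : (FreeGroup.mk [linv a] : FreeGroup (Fin m)) = (FreeGroup.mk [a])⁻¹ :=
    eq_inv_of_mul_eq_one_left (mk_linv_mul_mk a)
  change Set.indicator {g} 1 (walk n x * FreeGroup.mk [linv a]) = _
  simp only [Set.indicator, Set.mem_singleton_iff, hinv, mul_inv_eq_iff_eq_mul, Pi.one_apply]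

theorem IsUniformIncrements.exists_measure_walk_eq [IsProbabilityMeasure P]
    (hP : IsUniformIncrements P) (n : ℕ) :
    ∃ φ : ℕ → ℝ≥0∞, ∀ g : FreeGroup (Fin m), P (walk n ⁻¹' {g}) = φ (wlen g) := by
  induction n with
  | zero =>
    refine ⟨fun l => if l = 0 then 1 else 0, fun g => ?_⟩
    have hw : ∀ x : ℕ → Letter m, walk 0 x = 1 := fun x => rfl
    simp only [wlen_eq_zero_iff]
    split_ifs with h
    · simp [Set.preimage, hw, h]
    · simp [Set.preimage, hw, Ne.symm h]
  | succ n ih =>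
    obtain ⟨φ, hφ⟩ := ih
    refine ⟨fun l => ((2 * m : ℕ) : ℝ≥0∞)⁻¹ * if l = 0 then (2 * m : ℕ) * φ 1
      else φ (l - 1) + (2 * m - 1 : ℕ) * φ (l + 1), fun g => ?_⟩
    simp_rw [hP.measure_walk_succ, hφ, sum_wlen_mul_mk_singleton]

theorem inv_mul_sum_half_pow_le (hm : 2 ≤ m) (g : FreeGroup (Fin m)) :
    ((2 * m : ℕ) : ℝ≥0∞)⁻¹ * ∑ a : Letter m, (2⁻¹ : ℝ≥0∞) ^ wlen (g * FreeGroup.mk [a]) ≤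
      (7 / 8) * 2⁻¹ ^ wlen g := by
  rw [sum_wlen_mul_mk_singleton g fun l => (2⁻¹ : ℝ≥0∞) ^ l]
  have h0 : ((2 * m : ℕ) : ℝ≥0∞) ≠ 0 := by
    rw [Nat.cast_ne_zero]; omega
  rw [ENNReal.inv_mul_le_iff h0 (ENNReal.natCast_ne_top _)]
  obtain ⟨q, rfl⟩ := Nat.exists_eq_add_of_le hm
  have h2 : (2⁻¹ : ℝ≥0∞) = ((2⁻¹ : NNReal) : ℝ≥0∞) := by simp
  have h7 : (7 / 8 : ℝ≥0∞) = ((7 / 8 : NNReal) : ℝ≥0∞) := by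
    rw [ENNReal.coe_div (by norm_num)]; rfl
  have hq : 2 * (2 + q) - 1 = 3 + 2 * q := by omega
  generalize wlen g = l
  rw [h2, h7, hq]
  rcases l with - | l
  · simp only [if_true]
    norm_cast
    refine mul_le_mul_right ?_ _
    rw [← NNReal.coe_le_coe]
    norm_num
  · simp only [Nat.add_eq_zero_iff, one_ne_zero, and_false, if_false, Nat.add_sub_cancel]
    norm_cast
    rw [← NNReal.coe_le_coe]
    push_cast
    have ht : (0 : ℝ) ≤ 2⁻¹ ^ l := by positivity
    have hqt : 0 ≤ (q : ℝ) * 2⁻¹ ^ l := by positivity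
    rw [pow_succ _ (l + 1), pow_succ]
    linarith

theorem IsUniformIncrements.lintegral_half_pow_le [IsProbabilityMeasure P]
    (hP : IsUniformIncrements P) (hm : 2 ≤ m) (n : ℕ) :
    ∫⁻ x, (2⁻¹ : ℝ≥0∞) ^ wlen (walk n x) ∂P ≤ (7 / 8) ^ n := by
  induction n with
  | zero =>
    calc ∫⁻ x, (2⁻¹ : ℝ≥0∞) ^ wlen (walk 0 x) ∂P ≤ ∫⁻ _, 1 ∂P :=
          lintegral_mono fun x => pow_le_one' (by simp) _
      _ = (7 / 8) ^ 0 := by simp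
  | succ n ih =>
    have hmeas : ∀ φ : FreeGroup (Fin m) → ℝ≥0∞, Measurable fun x => φ (walk n x) :=
      fun φ => (Measurable.of_discrete (f := φ)).comp (measurable_walk n)
    rw [hP.lintegral_walk_succ n fun g => 2⁻¹ ^ wlen g,
      ← lintegral_finsetSum _ fun a _ => hmeas fun g => 2⁻¹ ^ wlen (g * FreeGroup.mk [a]),
      ← lintegral_const_mul _
        (hmeas fun g => ∑ a : Letter m, 2⁻¹ ^ wlen (g * FreeGroup.mk [a])), pow_succ']
    calc _ ≤ ∫⁻ x, (7 / 8) * (2⁻¹ : ℝ≥0∞) ^ wlen (walk n x) ∂P :=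
          lintegral_mono fun x => inv_mul_sum_half_pow_le hm _
      _ ≤ _ := by
        rw [lintegral_const_mul _ (hmeas fun g => 2⁻¹ ^ wlen g)]
        gcongr

/-- The simple random walk on a nonabelian free group is transient. -/
theorem IsUniformIncrements.ae_tendsto_wlen [IsProbabilityMeasure P]
    (hP : IsUniformIncrements P) (hm : 2 ≤ m) :
    ∀ᵐ x ∂P, Tendsto (fun n => wlen (walk n x)) atTop atTop := by
  have hmeas : ∀ n, Measurable fun x : ℕ → Letter m => (2⁻¹ : ℝ≥0∞) ^ wlen (walk n x) :=
    fun n => (Measurable.of_discrete (f := fun g => (2⁻¹ : ℝ≥0∞) ^ wlen g)).comp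
      (measurable_walk n)
  have hsum : ∫⁻ x, ∑' n, (2⁻¹ : ℝ≥0∞) ^ wlen (walk n x) ∂P ≠ ∞ := by
    rw [lintegral_tsum fun n => (hmeas n).aemeasurable]
    refine ne_top_of_le_ne_top ?_ (ENNReal.tsum_le_tsum (hP.lintegral_half_pow_le hm))
    rw [ENNReal.tsum_geometric, ne_eq, ENNReal.inv_eq_top, tsub_eq_zero_iff_le, not_le]
    exact ENNReal.div_lt_of_lt_mul (by norm_num)
  filter_upwards [ae_lt_top (Measurable.tsum hmeas) hsum] with x hx
  refine tendsto_atTop.2 fun b => ?_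
  have hpos : (0 : ℝ≥0∞) < 2⁻¹ ^ b := ENNReal.pow_pos (by simp) b
  filter_upwards [(ENNReal.tendsto_atTop_zero_of_tsum_ne_top hx.ne).eventually_lt_const hpos]
    with n hn
  by_contra! hlt
  exact hn.not_ge (pow_le_pow_right_of_le_one' (by simp) hlt.le)

theorem measurable_trunc (n : ℕ) : Measurable fun ω : Boundary m => trunc ω n :=
  (measurable_walk n).comp measurable_subtype_coe

theorem measurableSet_cylinder_boundary (g : FreeGroup (Fin m)) :
    MeasurableSet (_root_.cylinder g) :=
  measurable_trunc (wlen g) (measurableSet_singleton g)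

theorem mem_cylinder_iff_prefix {g h : FreeGroup (Fin m)} {ω : Boundary m}
    (hω : ∀ i < wlen g, h.toWord[i]? = some (ω.1 i)) :
    ω ∈ _root_.cylinder g ↔ g.toWord <+: h.toWord := by
  rw [mem_cylinder_iff, List.prefix_iff_getElem?]
  refine forall₂_congr fun i hi => ?_
  rw [hω i hi, List.getElem?_eq_getElem hi, eq_comm]

theorem cylinder_subset_cylinder {g h : FreeGroup (Fin m)} (hle : wlen g ≤ wlen h)
    {ω : Boundary m} (hg : ω ∈ _root_.cylinder g) (hh : ω ∈ _root_.cylinder h) :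
    _root_.cylinder h ⊆ _root_.cylinder g := by
  rw [mem_cylinder_iff] at hg hh
  refine fun η hη => mem_cylinder_iff.2 fun i hi => ?_
  rw [hg i hi, ← hh i (hi.trans_le hle), mem_cylinder_iff.1 hη i (hi.trans_le hle)]

theorem isPiSystem_cylinder :
    IsPiSystem (Set.range (_root_.cylinder : FreeGroup (Fin m) → Set (Boundary m))) := by
  rintro _ ⟨g, rfl⟩ _ ⟨h, rfl⟩ ⟨ω, hg, hh⟩
  rcases le_total (wlen g) (wlen h) with hle | hle
  · exact ⟨h, (Set.inter_eq_right.2 (cylinder_subset_cylinder hle hg hh)).symm⟩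
  · exact ⟨g, (Set.inter_eq_left.2 (cylinder_subset_cylinder hle hh hg)).symm⟩

theorem measurableSpace_boundary_eq_generateFrom_cylinder :
    (inferInstance : MeasurableSpace (Boundary m)) =
      MeasurableSpace.generateFrom (Set.range _root_.cylinder) := by
  refine le_antisymm ?_ (MeasurableSpace.generateFrom_le ?_)
  · change MeasurableSpace.comap Subtype.val _ ≤ _
    let := MeasurableSpace.generateFrom (Set.range (_root_.cylinder (m := m)))
    refine (@measurable_pi_lambda (Boundary m) ℕ _ this _ _ fun k => ?_).comap_le
    refine @measurable_to_countable' _ _ _ _ this _ fun a => ?_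
    have hset : (fun ω : Boundary m => ω.1 k) ⁻¹' {a} =
        ⋃ g ∈ {g : FreeGroup (Fin m) | wlen g = k + 1 ∧ g.toWord[k]? = some a},
          _root_.cylinder g := by
      ext ω
      simp only [Set.mem_preimage, Set.mem_singleton_iff, Set.mem_iUnion, exists_prop]
      constructor
      · rintro rfl
        refine ⟨trunc ω (k + 1), ⟨wlen_trunc ω _, by simp [toWord_trunc, -List.ofFn_succ]⟩, ?_⟩
        change trunc ω (wlen _) = _
        rw [wlen_trunc]
      · rintro ⟨g, ⟨hg, hga⟩, hω⟩
        rw [mem_cylinder_iff.1 hω k (by omega), Option.some_inj] at hga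
        exact hga
    rw [hset]
    exact @MeasurableSet.biUnion _ _ this _ _ (Set.to_countable _) fun g _ =>
      MeasurableSpace.measurableSet_generateFrom ⟨g, rfl⟩
  · rintro _ ⟨g, rfl⟩
    exact measurableSet_cylinder_boundary g

theorem trunc_fiber_eq_empty {g : FreeGroup (Fin m)} {n : ℕ} (h : wlen g ≠ n) :
    {ω : Boundary m | trunc ω n = g} = ∅ := by
  refine Set.eq_empty_of_forall_notMem fun ω hω => h ?_
  rw [← show trunc ω n = g from hω, wlen_trunc]

/-- A probability measure on the free group which is uniform on spheres is obtained by truncating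
at its own random length a boundary point whose law is uniform on cylinders. -/
theorem measure_eq_lintegral_measure_trunc (ρ : Measure (FreeGroup (Fin m)))
    (hρ : ∀ g h, wlen g = wlen h → ρ {g} = ρ {h})
    (μ : Measure (Boundary m)) [IsProbabilityMeasure μ]
    (hμ : ∀ g h : FreeGroup (Fin m), wlen g = wlen h →
      μ (_root_.cylinder g) = μ (_root_.cylinder h))
    (s : Set (FreeGroup (Fin m))) :
    ρ s = ∫⁻ h, μ {ω | trunc ω (wlen h) ∈ s} ∂ρ := by
  have hker : Measurable fun h : FreeGroup (Fin m) =>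
      μ.map fun ω => trunc ω (wlen h) := Measurable.of_discrete
  have hbind : ∀ s, ρ.bind (fun h => μ.map fun ω => trunc ω (wlen h)) s =
      ∫⁻ h, μ {ω | trunc ω (wlen h) ∈ s} ∂ρ := fun s => by
    rw [Measure.bind_apply .of_discrete hker.aemeasurable]
    refine lintegral_congr fun h => ?_
    rw [Measure.map_apply (measurable_trunc _) .of_discrete]
    rfl
  rw [← hbind]
  congr 1
  refine Measure.ext_of_singleton fun g => ?_
  have hterm : ∀ h, μ {ω | trunc ω (wlen h) ∈ ({g} : Set (FreeGroup (Fin m)))} * ρ {h} =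
      ρ {g} * (1 * μ.map (fun ω => trunc ω (wlen g)) {h}) := fun h => by
    rw [Measure.map_apply (measurable_trunc _) .of_discrete, one_mul, mul_comm]
    rcases eq_or_ne (wlen h) (wlen g) with hgh | hgh
    · rw [hρ h g hgh, hgh]
      congr 1
      change μ (_root_.cylinder g) = μ {ω | trunc ω (wlen g) = h}
      rw [← hgh, hμ g h hgh.symm]
      rfl
    · have h₁ := trunc_fiber_eq_empty hgh
      have h₂ := trunc_fiber_eq_empty hgh.symm
      simp only [Set.preimage, Set.mem_singleton_iff, h₁, h₂, measure_empty, mul_zero]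
  have := Measure.isProbabilityMeasure_map (μ := μ) (measurable_trunc (wlen g)).aemeasurable
  rw [hbind, lintegral_countable', tsum_congr hterm, ENNReal.tsum_mul_left,
    ← lintegral_countable' (fun _ => 1), lintegral_one, measure_univ, mul_one]

theorem IsUniformIncrements.measure_prefix_walk [IsProbabilityMeasure P]
    (hP : IsUniformIncrements P) {μ : Measure (Boundary m)} [IsProbabilityMeasure μ]
    (hμ : ∀ g h : FreeGroup (Fin m), wlen g = wlen h →
      μ (_root_.cylinder g) = μ (_root_.cylinder h))
    (n : ℕ) (g : FreeGroup (Fin m)) :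
    P {x | g.toWord <+: (walk n x).toWord} =
      μ (_root_.cylinder g) * P {x | wlen g ≤ wlen (walk n x)} := by
  obtain ⟨φ, hφ⟩ := hP.exists_measure_walk_eq n
  have hρ : ∀ h₁ h₂ : FreeGroup (Fin m), wlen h₁ = wlen h₂ →
      P.map (walk n) {h₁} = P.map (walk n) {h₂} := fun h₁ h₂ h => by
    simp_rw [Measure.map_apply (measurable_walk n) .of_discrete, hφ, h]
  have key := measure_eq_lintegral_measure_trunc _ hρ μ hμ {h | g.toWord <+: h.toWord}
  have hind : ∀ h : FreeGroup (Fin m), μ {ω | trunc ω (wlen h) ∈ {h | g.toWord <+: h.toWord}} =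
      Set.indicator {h | wlen g ≤ wlen h} (fun _ => μ (_root_.cylinder g)) h := fun h => by
    simp only [Set.mem_ofPred_eq, prefix_trunc_iff, Set.indicator]
    split_ifs with hle <;> simp [hle]
  rw [lintegral_congr hind, lintegral_indicator_const .of_discrete,
    Measure.map_apply (measurable_walk n) .of_discrete,
    Measure.map_apply (measurable_walk n) .of_discrete] at key
  exact key

theorem exists_eventually_getElem?_toWord_walk {x : ℕ → Letter m}
    (hx : Tendsto (fun n => wlen (walk n x)) atTop atTop) (k : ℕ) :
    ∃ a, ∀ᶠ n in atTop, (walk n x).toWord[k]? = some a := by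
  obtain ⟨N, hN⟩ := eventually_atTop.1 (hx.eventually_ge_atTop (k + 1))
  have htake : ∀ n ≥ N, (walk n x).toWord.take (k + 1) = (walk N x).toWord.take (k + 1) := by
    intro n hn
    induction n, hn using Nat.le_induction with
    | base => rfl
    | succ n hn ih =>
      rw [← ih, walk_succ]
      exact take_toWord_mul_mk_singleton _ _ (hN n hn) (walk_succ n x ▸ hN (n + 1) (by omega))
  have hk : k < (walk N x).toWord.length := hN N le_rfl
  refine ⟨(walk N x).toWord[k], eventually_atTop.2 ⟨N, fun n hn => ?_⟩⟩
  rw [← List.getElem?_take_of_lt k.lt_succ_self, htake n hn,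
    List.getElem?_take_of_lt k.lt_succ_self, List.getElem?_eq_getElem hk]

theorem exists_boundary_limit {x : ℕ → Letter m}
    (hx : Tendsto (fun n => wlen (walk n x)) atTop atTop) :
    ∃ ω : Boundary m, ∀ k, ∀ᶠ n in atTop, ∀ i < k, (walk n x).toWord[i]? = some (ω.1 i) := by
  choose ω hω using exists_eventually_getElem?_toWord_walk hx
  refine ⟨⟨ω, fun k hk => ?_⟩, fun k => ?_⟩
  · obtain ⟨n, h₁, h₂⟩ := ((hω k).and (hω (k + 1))).exists
    obtain ⟨_, h₁⟩ := List.getElem?_eq_some_iff.1 h₁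
    obtain ⟨hlt, h₂⟩ := List.getElem?_eq_some_iff.1 h₂
    exact toWord_chain _ hlt (by rw [h₁, h₂, hk])
  · exact (eventually_all_finite (Set.finite_lt_nat k)).2 fun i _ => hω i

theorem measurableSet_eventually_walk (p : ℕ → FreeGroup (Fin m) → Prop) :
    MeasurableSet {x : ℕ → Letter m | ∀ᶠ n in atTop, p n (walk n x)} := by
  have h : {x : ℕ → Letter m | ∀ᶠ n in atTop, p n (walk n x)} =
      ⋃ N, ⋂ n ≥ N, {x | p n (walk n x)} := by
    ext x
    simp
  rw [h]
  exact .iUnion fun N => .iInter fun n => .iInter fun _ => measurableSet_walk n (p n)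

theorem measurableSet_tendsto_wlen_walk :
    MeasurableSet {x : ℕ → Letter m | Tendsto (fun n => wlen (walk n x)) atTop atTop} := by
  simp only [tendsto_atTop, Set.ofPred_forall]
  exact .iInter fun b => measurableSet_eventually_walk fun _ g => b ≤ wlen g

theorem exists_measurable_limit [Nonempty (Boundary m)] :
    ∃ W : (ℕ → Letter m) → Boundary m, Measurable W ∧
      ∀ x, Tendsto (fun n => wlen (walk n x)) atTop atTop →
        ∀ k, ∀ᶠ n in atTop, ∀ i < k, (walk n x).toWord[i]? = some ((W x).1 i) := by
  classical
  obtain ⟨ω₀⟩ := ‹Nonempty (Boundary m)›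
  let W : (ℕ → Letter m) → Boundary m := fun x =>
    if hx : Tendsto (fun n => wlen (walk n x)) atTop atTop then (exists_boundary_limit hx).choose
    else ω₀
  have hW : ∀ x, Tendsto (fun n => wlen (walk n x)) atTop atTop →
      ∀ k, ∀ᶠ n in atTop, ∀ i < k, (walk n x).toWord[i]? = some ((W x).1 i) := fun x hx => by
    simp only [W, dif_pos hx]
    exact (exists_boundary_limit hx).choose_spec
  refine ⟨W, ?_, hW⟩
  refine Measurable.subtype_mk (f := fun x => (W x).1) (measurable_pi_iff.2 fun k => ?_)
  refine measurable_to_countable' fun a => ?_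
  have hset : (fun x => (W x).1 k) ⁻¹' {a} =
      {x | Tendsto (fun n => wlen (walk n x)) atTop atTop}.ite
        {x | ∀ᶠ n in atTop, (walk n x).toWord[k]? = some a} {_x | ω₀.1 k = a} := by
    ext x
    by_cases hx : Tendsto (fun n => wlen (walk n x)) atTop atTop
    · have hk := (hW x hx (k + 1)).mono fun n hn => hn k k.lt_succ_self
      simp only [Set.ite, Set.mem_preimage, Set.mem_singleton_iff, Set.mem_union, Set.mem_inter_iff,
        Set.mem_sdiff, Set.mem_ofPred_eq, hx, not_true_eq_false, and_true, and_false, or_false]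
      constructor
      · rintro rfl
        exact hk
      · intro ha
        obtain ⟨n, h₁, h₂⟩ := (hk.and ha).exists
        exact Option.some_inj.1 (h₁.symm.trans h₂)
    · simp [Set.ite, W, hx]
  rw [hset]
  exact measurableSet_tendsto_wlen_walk.ite
    (measurableSet_eventually_walk fun _ g => g.toWord[k]? = some a) (.const _)

end RandomWalk

/-- **Convergence of the simple random walk to the boundary, with harmonic measure `μ`.**
`P` is the product of uniform measures on letters; `gₙ(x) = x₁⋯xₙ` is the simple random
walk on `F`. For `P`-a.e. `x` the walk converges to a (necessarily unique) boundary point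
`W x`, in the sense that the Gromov products `(gₙ(x) | W x)` tend to infinity, and the
distribution of the limit point is the uniform measure `μ`. -/
theorem simple_random_walk_converges_to_uniform_measure (m : ℕ) (hm : 2 ≤ m)
    (μ : Measure (Boundary m)) [IsProbabilityMeasure μ]
    (hμ : ∀ g : FreeGroup (Fin m), g ≠ 1 →
      μ (cylinder g) = ((2 * m * (2 * m - 1) ^ (wlen g - 1) : ℕ) : ℝ≥0∞)⁻¹)
    (P : Measure (ℕ → Letter m)) [IsProbabilityMeasure P]
    (hP : ∀ (n : ℕ) (f : Fin n → Letter m),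
      P {x | ∀ i : Fin n, x i = f i} = (((2 * m : ℕ) : ℝ≥0∞))⁻¹ ^ n) :
    ∃ W : (ℕ → Letter m) → Boundary m,
      Measurable W ∧
      (∀ᵐ x ∂P, Tendsto
        (fun n : ℕ => (gromov (FreeGroup.mk (List.ofFn fun i : Fin n => x i)) (W x) : ℕ))
        atTop atTop) ∧
      -- uniqueness of the boundary limit point
      (∀ (x : ℕ → Letter m) (ω₁ ω₂ : Boundary m),
        Tendsto (fun n : ℕ => gromov (FreeGroup.mk (List.ofFn fun i : Fin n => x i)) ω₁)
          atTop atTop →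
        Tendsto (fun n : ℕ => gromov (FreeGroup.mk (List.ofFn fun i : Fin n => x i)) ω₂)
          atTop atTop →
        ω₁ = ω₂) ∧
      Measure.map W P = μ := by
  have : Nonempty (Boundary m) := nonempty_of_isProbabilityMeasure μ
  have hP' : IsUniformIncrements P := hP
  have hμ' : ∀ g h : FreeGroup (Fin m), wlen g = wlen h →
      μ (_root_.cylinder g) = μ (_root_.cylinder h) := by
    intro g h hgh
    rcases eq_or_ne g 1 with rfl | hg
    · rw [wlen_eq_zero_iff.2 rfl, eq_comm, wlen_eq_zero_iff] at hgh
      rw [hgh]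
    · have hh : h ≠ 1 := fun h1 => hg (by
        rwa [h1, wlen_eq_zero_iff.2 rfl, wlen_eq_zero_iff] at hgh)
      rw [hμ g hg, hμ h hh, hgh]
  obtain ⟨W, hW, hWlim⟩ := exists_measurable_limit (m := m)
  have hgood := (hP'.ae_tendsto_wlen hm).mono hWlim
  refine ⟨W, hW, ?_, fun x ω₁ ω₂ => eq_of_tendsto_gromov, ?_⟩
  · filter_upwards [hgood] with x hx
    exact tendsto_atTop.2 fun k => (hx k).mono fun n hn => le_gromov_iff.2 hn
  · have := Measure.isProbabilityMeasure_map (μ := P) hW.aemeasurable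
    refine ext_of_generate_finite _ measurableSpace_boundary_eq_generateFrom_cylinder
      isPiSystem_cylinder ?_ (by simp)
    rintro _ ⟨g, rfl⟩
    rw [Measure.map_apply hW (measurableSet_cylinder_boundary g)]
    have h₁ : Tendsto (fun n => P {x | g.toWord <+: (walk n x).toWord}) atTop
        (𝓝 (P (W ⁻¹' _root_.cylinder g))) := by
      refine tendsto_measure_of_ae_tendsto_indicator_of_isFiniteMeasure atTop
        (hW (measurableSet_cylinder_boundary g))
        (fun n => measurableSet_walk n fun h => g.toWord <+: h.toWord) ?_
      filter_upwards [hgood] with x hx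
      filter_upwards [hx (wlen g)] with n hn
      exact (mem_cylinder_iff_prefix hn).symm
    have h₂ : Tendsto (fun n => P {x | wlen g ≤ wlen (walk n x)}) atTop (𝓝 (P Set.univ)) := by
      refine tendsto_measure_of_ae_tendsto_indicator_of_isFiniteMeasure atTop
        MeasurableSet.univ (fun n => measurableSet_walk n fun h => wlen g ≤ wlen h) ?_
      filter_upwards [hP'.ae_tendsto_wlen hm] with x hx
      filter_upwards [hx.eventually_ge_atTop (wlen g)] with n hn
      simpa using hn
    have h₃ := ENNReal.Tendsto.const_mul (a := μ (_root_.cylinder g)) h₂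
      (Or.inr (measure_ne_top _ _))
    rw [measure_univ, mul_one] at h₃
    refine tendsto_nhds_unique h₁ (h₃.congr fun n => ?_)
    exact (hP'.measure_prefix_walk hμ' n g).symm
end
end

section
/- Let G be a countable group acting measurably on a standard Borel probability space (X, 𝔪) such that the action is nonsingular (for every g ∈ G the pushforward measure g_*𝔪, defined by g_*𝔪(E) = 𝔪(g⁻¹E), is mutually absolutely continuous with 𝔪) and essentially free (for 𝔪-a.e. x ∈ X, gx = x implies g is the identity). Fix measurable versions of the Radon–Nikodym derivatives d(g_*𝔪)/d𝔪 and set C = { x ∈ X : Σ_{g∈G} (d(g_*𝔪)/d𝔪)(x) = ∞ }. Then: (i) every measurable A ⊆ C with 𝔪(A) > 0 is recurrent, i.e. there exists g ∈ G with g ≠ identity and 𝔪(A ∩ gA) > 0; and (ii) there exists a measurable set W ⊆ X with 𝔪(gW ∩ g′W) = 0 for all g ≠ g′ in G, such that ⋃_{g∈G} gW coincides with X \ C up to an 𝔪-null set. (Thus C is, mod 0, the conservative part and X \ C the completely dissipative part of the Hopf decomposition of the action.) -/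
open MeasureTheory Filter
open scoped ENNReal symmDiff

section RadonNikodymCocycle

variable {G X : Type*} [Group G] [MeasurableSpace X] [MulAction G X]
  {μ : Measure X} {D : G → X → ℝ≥0∞}

/-- Densities of the translates of a finite measure form a multiplicative cocycle almost
everywhere. -/
theorem ae_cocycle_of_withDensity_eq_map_smul [MeasurableConstSMul G X] [IsFiniteMeasure μ]
    (hDmeas : ∀ g, Measurable (D g))
    (hD : ∀ g, μ.withDensity (D g) = μ.map (fun x => g • x)) (g h : G) :
    ∀ᵐ x ∂μ, D (g * h) x = D g x * D h (g⁻¹ • x) := by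
  have hm (k : G) : Measurable (fun x : X => k • x) := measurable_const_smul k
  have hcomp : Measurable (fun x => D h (g⁻¹ • x)) := (hDmeas h).comp (hm _)
  have key : μ.withDensity (D (g * h)) = μ.withDensity (D g * fun x => D h (g⁻¹ • x)) := by
    rw [withDensity_mul _ (hDmeas g) hcomp, hD, hD]
    ext E hE
    rw [withDensity_apply _ hE, setLIntegral_map hE hcomp (hm g)]
    simp only [inv_smul_smul]
    rw [← withDensity_apply _ (hm g hE), hD, Measure.map_apply (hm h) (hm g hE),
      Measure.map_apply (hm _) hE]
    congr 1
    ext x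
    simp [mul_smul]
  refine (withDensity_eq_iff (hDmeas _).aemeasurable ((hDmeas g).mul hcomp).aemeasurable ?_).1 key
  rw [← setLIntegral_univ, ← withDensity_apply _ MeasurableSet.univ, hD]
  have : IsFiniteMeasure (μ.map (fun x => (g * h) • x)) := Measure.isFiniteMeasure_map _ _
  exact measure_ne_top _ _

theorem ae_density_one_eq_one [SigmaFinite μ] (hDmeas : Measurable (D 1))
    (hD : μ.withDensity (D 1) = μ.map (fun x => (1 : G) • x)) :
    ∀ᵐ x ∂μ, D 1 x = 1 := by
  have key : μ.withDensity (D 1) = μ.withDensity 1 := by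
    simp only [hD, one_smul, withDensity_one]
    exact Measure.map_id
  exact (withDensity_eq_iff_of_sigmaFinite hDmeas.aemeasurable aemeasurable_one).1 key

/-- If the translates of `A` are almost disjoint, then the densities of the translates of a finite
measure are almost everywhere summable on `A`. -/
theorem ae_tsum_density_ne_top_of_wandering [MeasurableConstSMul G X] [Countable G]
    [IsFiniteMeasure μ] (hDmeas : ∀ g, Measurable (D g))
    (hD : ∀ g, μ.withDensity (D g) = μ.map (fun x => g • x))
    (hns : ∀ g : G, μ.map (fun x => g • x) ≪ μ) {A : Set X} (hA : MeasurableSet A)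
    (hw : ∀ g : G, g ≠ 1 → μ (A ∩ (fun x => g • x) '' A) = 0) :
    ∀ᵐ x ∂μ.restrict A, ∑' g, D g x ≠ ∞ := by
  have hm (k : G) : Measurable (fun x : X => k • x) := measurable_const_smul k
  have hdisj : Pairwise (Function.onFun (AEDisjoint μ) fun g : G => (fun x : X => g • x) ⁻¹' A) := by
    intro g h hgh
    have h0 := hw (g * h⁻¹) (by simpa [mul_inv_eq_one] using hgh)
    have h1 := (Measure.QuasiMeasurePreserving.mk (hm g) (hns g)).preimage_null h0
    refine measure_mono_null ?_ h1
    rintro x ⟨hx, hx'⟩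
    exact ⟨hx, h • x, hx', by simp [mul_smul]⟩
  have hsum : ∫⁻ x in A, ∑' g, D g x ∂μ ≠ ∞ := by
    rw [lintegral_tsum fun g => (hDmeas g).aemeasurable]
    have (g : G) : ∫⁻ x in A, D g x ∂μ = μ ((fun x => g • x) ⁻¹' A) := by
      rw [← withDensity_apply _ hA, hD, Measure.map_apply (hm g) hA]
    simp only [this]
    rw [← measure_iUnion₀ hdisj fun g => (hm g hA).nullMeasurableSet]
    exact measure_ne_top _ _
  filter_upwards [ae_lt_top (Measurable.tsum hDmeas) hsum] with x hx using hx.ne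

end RadonNikodymCocycle

section MaximalDensity

variable {G X : Type*} [Group G] [MulAction G X] {D : G → X → ℝ≥0∞} {φ : X → ℝ} {x : X}

/-- The point `x` is the maximum of its orbit for the density, ties being broken by the smallest
value of `φ`. -/
def IsOrbitMax (D : G → X → ℝ≥0∞) (φ : X → ℝ) (x : X) : Prop :=
  ∀ h : G, h ≠ 1 → D h x < 1 ∨ (D h x = 1 ∧ φ x < φ (h⁻¹ • x))

theorem measurableSet_isOrbitMax [MeasurableSpace X] [MeasurableConstSMul G X] [Countable G]
    (hD : ∀ g, Measurable (D g)) (hφ : Measurable φ) : MeasurableSet {x | IsOrbitMax D φ x} := by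
  simp only [IsOrbitMax, Set.ofPred_forall, Set.ofPred_or, Set.ofPred_and]
  refine MeasurableSet.iInter fun h => MeasurableSet.iInter fun _ => ?_
  exact (measurableSet_lt (hD h) measurable_const).union
    ((measurableSet_eq_fun (hD h) measurable_const).inter
      (measurableSet_lt hφ (hφ.comp (measurable_const_smul h⁻¹))))

/-- An orbit has at most one maximum. -/
theorem IsOrbitMax.eq_one_of_smul (hx : IsOrbitMax D φ x) {k : G} (hkx : IsOrbitMax D φ (k • x))
    (hcocycle : D k⁻¹ x * D k (k • x) = 1) : k = 1 := by
  by_contra hk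
  have h1 := hx k⁻¹ (by simpa using hk)
  have h2 := hkx k hk
  simp only [inv_inv, inv_smul_smul] at h1 h2
  rcases h1 with h1 | ⟨h1, h1'⟩
  · have h2' : D k (k • x) ≤ 1 := h2.elim le_of_lt fun h => h.1.le
    refine absurd hcocycle (ne_of_lt ?_)
    calc D k⁻¹ x * D k (k • x) ≤ D k⁻¹ x * 1 := by gcongr
      _ < 1 := by simpa using h1
  · rcases h2 with h2 | ⟨-, h2'⟩
    · rw [h1, one_mul] at hcocycle
      exact h2.ne hcocycle
    · exact lt_asymm h1' h2'

/-- A free orbit along which the density is summable has a maximum. -/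
theorem exists_isOrbitMax_inv_smul (hone : D 1 x = 1)
    (hcocycle : ∀ g h : G, D (g * h) x = D g x * D h (g⁻¹ • x))
    (hfree : ∀ g : G, g • x = x → g = 1) (hφ : Function.Injective φ)
    (hsum : ∑' g, D g x ≠ ∞) : ∃ g : G, IsOrbitMax D φ (g⁻¹ • x) := by
  have hfin : {g : G | 1 ≤ D g x}.Finite := ENNReal.finite_const_le_of_tsum_ne_top hsum one_ne_zero
  obtain ⟨g, hg, hmax⟩ := hfin.exists_maximalFor
    (fun g => toLex (D g x, OrderDual.toDual (φ (g⁻¹ • x)))) _ ⟨1, hone.ge⟩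
  have hg0 : D g x ≠ 0 := (zero_lt_one.trans_le hg).ne'
  have hgtop : D g x ≠ ∞ := ENNReal.ne_top_of_tsum_ne_top hsum g
  refine ⟨g, fun h hh => ?_⟩
  have hmul := hcocycle g h
  have hle : D (g * h) x ≤ D g x := by
    by_contra! hlt
    have := hmax (j := g * h) (hg.trans hlt.le) (by
      rw [Prod.Lex.toLex_le_toLex]; exact Or.inl hlt)
    rw [Prod.Lex.toLex_le_toLex] at this
    rcases this with h' | h'
    · exact lt_asymm hlt h'
    · exact hlt.ne' h'.1
  rcases hle.lt_or_eq with hlt | heq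
  · left
    rw [hmul] at hlt
    by_contra! h1
    exact hlt.not_ge (le_mul_of_one_le_right' h1)
  · right
    refine ⟨?_, ?_⟩
    · rw [heq] at hmul
      exact ((ENNReal.mul_right_inj hg0 hgtop).1 (by rw [← hmul, mul_one]))
    · rw [← mul_smul, ← mul_inv_rev]
      by_contra! h1
      have := hmax (j := g * h) (hg.trans heq.ge) (by
        rw [Prod.Lex.toLex_le_toLex]; exact Or.inr ⟨heq.symm, h1⟩)
      rw [Prod.Lex.toLex_le_toLex] at this
      rcases this with h' | h'
      · exact h'.ne heq
      · have h2 : φ (g⁻¹ • x) = φ ((g * h)⁻¹ • x) := le_antisymm h'.2 h1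
        have h3 := hφ h2
        apply hh
        have h4 := hfree (g * h * g⁻¹) (by rw [mul_smul, h3, smul_inv_smul])
        simpa using h4

/-- Divergence of the sum of the densities passes to the rest of the orbit. -/
theorem tsum_density_eq_top_of_smul {g : G} (hg : D g⁻¹ x ≠ 0)
    (hcocycle : ∀ h : G, D (g⁻¹ * h) x = D g⁻¹ x * D h (g • x))
    (hsum : ∑' h, D h (g • x) = ∞) : ∑' h, D h x = ∞ := by
  rw [← (Equiv.mulLeft g⁻¹).tsum_eq]
  simp only [Equiv.coe_mulLeft, hcocycle, ENNReal.tsum_mul_left, hsum]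
  exact ENNReal.mul_top hg

end MaximalDensity

/-- **Hopf decomposition via Radon–Nikodym derivatives.** For a countable group `G` acting
nonsingularly and essentially freely on a standard Borel probability space `(X, 𝔪)`, the
set `C` where the sum of the Radon–Nikodym derivatives diverges is (mod 0) the
conservative part, and its complement is the completely dissipative part. -/
theorem hopf_decomposition_radon_nikodym {G : Type*} [Group G] [Countable G]
    {X : Type*} [MeasurableSpace X] [StandardBorelSpace X]
    (𝔪 : Measure X) [IsProbabilityMeasure 𝔪] [MulAction G X]
    (hmeas : ∀ g : G, Measurable (fun x : X => g • x))
    (hns : ∀ g : G, Measure.map (fun x : X => g • x) 𝔪 ≪ 𝔪 ∧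
      𝔪 ≪ Measure.map (fun x : X => g • x) 𝔪)
    (hfree : ∀ᵐ x ∂𝔪, ∀ g : G, g • x = x → g = 1)
    (D : G → X → ℝ≥0∞)
    (hDmeas : ∀ g : G, Measurable (D g))
    (hD : ∀ g : G, D g =ᵐ[𝔪] (Measure.map (fun x : X => g • x) 𝔪).rnDeriv 𝔪)
    (C : Set X) (hC : C = {x | ∑' g : G, D g x = ⊤}) :
    -- (i) every positive measure subset of C is recurrent
    (∀ A : Set X, MeasurableSet A → A ⊆ C → 0 < 𝔪 A →
      ∃ g : G, g ≠ 1 ∧ 0 < 𝔪 (A ∩ (fun x : X => g • x) '' A)) ∧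
    -- (ii) X \ C is covered (mod 0) by the translates of a wandering set
    (∃ W : Set X, MeasurableSet W ∧
      (∀ g g' : G, g ≠ g' → 𝔪 ((fun x : X => g • x) '' W ∩ (fun x : X => g' • x) '' W) = 0) ∧
      𝔪 ((⋃ g : G, (fun x : X => g • x) '' W) ∆ Cᶜ) = 0) := by
  have : MeasurableConstSMul G X := ⟨hmeas⟩
  have hdens (g : G) : 𝔪.withDensity (D g) = 𝔪.map (fun x => g • x) := by
    rw [withDensity_congr_ae (hD g)]
    have : IsFiniteMeasure (𝔪.map (fun x : X => g • x)) := Measure.isFiniteMeasure_map _ _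
    exact Measure.withDensity_rnDeriv_eq _ _ (hns g).1
  subst hC
  refine ⟨fun A hA hAC hpos => ?_, ?_⟩
  · by_contra! hw
    have h1 := ae_tsum_density_ne_top_of_wandering hDmeas hdens (fun g => (hns g).1) hA
      fun g hg => nonpos_iff_eq_zero.1 (hw g hg)
    rw [ae_restrict_iff' hA] at h1
    refine hpos.ne' (measure_mono_null (fun x hx => ?_) h1)
    exact fun h => h hx (hAC hx)
  · have hgood : ∀ᵐ x ∂𝔪, D 1 x = 1 ∧ (∀ g h : G, D (g * h) x = D g x * D h (g⁻¹ • x)) ∧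
        ∀ g : G, g • x = x → g = 1 := by
      filter_upwards [ae_density_one_eq_one (hDmeas 1) (hdens 1), hfree,
        ae_all_iff.2 fun g => ae_all_iff.2 fun h =>
          ae_cocycle_of_withDensity_eq_map_smul hDmeas hdens g h] with x h1 h2 h3
        using ⟨h1, h3, h2⟩
    obtain ⟨M₀, hM₀, hM₀meas, hM₀good⟩ := hgood.exists_measurable_mem
    set M : Set X := {x | ∀ g : G, g • x ∈ M₀} with hMdef
    have hMmeas : MeasurableSet M := by
      simp only [hMdef, Set.ofPred_forall]
      exact MeasurableSet.iInter fun g => hmeas g hM₀meas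
    have hMae : ∀ᵐ x ∂𝔪, x ∈ M := ae_all_iff.2 fun g =>
      (Measure.QuasiMeasurePreserving.mk (hmeas g) (hns g).1).ae hM₀
    have hMsmul (g : G) {x : X} (hx : x ∈ M) : g • x ∈ M := fun k => by
      rw [← mul_smul]; exact hx _
    have hMgood {x : X} (hx : x ∈ M) := hM₀good x (by simpa using hx 1)
    obtain ⟨φ, hφ⟩ := exists_measurableEmbedding_real X
    have hinv {x : X} (hx : x ∈ M) (k : G) : D k⁻¹ x * D k (k • x) = 1 := by
      have := (hMgood hx).2.1 k⁻¹ k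
      rw [inv_mul_cancel, inv_inv, (hMgood hx).1] at this
      exact this.symm
    refine ⟨(M ∩ {x | ∑' g, D g x = ⊤}ᶜ) ∩ {x | IsOrbitMax D φ x}, ?_, ?_, ?_⟩
    · exact (hMmeas.inter (measurableSet_eq_fun (Measurable.tsum hDmeas)
        measurable_const).compl).inter (measurableSet_isOrbitMax hDmeas hφ.measurable)
    · intro g g' hgg'
      convert measure_empty (μ := 𝔪)
      rw [← Set.disjoint_iff_inter_eq_empty, Set.disjoint_left]
      rintro _ ⟨w, ⟨⟨hwM, -⟩, hw⟩, rfl⟩ ⟨w', ⟨-, hw'⟩, heq⟩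
      have hk : w' = (g'⁻¹ * g) • w := by
        rw [mul_smul, eq_inv_smul_iff]; exact heq
      rw [hk] at hw'
      have := hw.eq_one_of_smul hw' (hinv hwM _)
      exact hgg' (inv_mul_eq_one.1 this).symm
    · refine measure_mono_null (t := Mᶜ) ?_ hMae
      intro x hx hxM
      rcases hx with ⟨hx, hxC⟩ | ⟨hxC, hx⟩
      · obtain ⟨g, w, ⟨⟨hwM, hwC⟩, -⟩, rfl⟩ := Set.mem_iUnion.1 hx
        refine hwC (tsum_density_eq_top_of_smul (g := g) ?_ (fun h => ?_) (not_not.1 hxC))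
        · exact left_ne_zero_of_mul_eq_one (hinv hwM g)
        · simpa using (hMgood hwM).2.1 g⁻¹ h
      · obtain ⟨h1, h2, h3⟩ := hMgood hxM
        obtain ⟨g, hg⟩ := exists_isOrbitMax_inv_smul h1 h2 h3 hφ.injective hxC
        refine hx (Set.mem_iUnion.2 ⟨g, g⁻¹ • x, ⟨⟨hMsmul _ hxM, fun htop => hxC ?_⟩, hg⟩, by simp⟩)
        refine tsum_density_eq_top_of_smul (g := g⁻¹) ?_ (fun h => ?_) htop
        · exact left_ne_zero_of_mul_eq_one (hinv hxM _)
        · simpa using h2 g h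
end
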